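/- arXiv:2201.02781 — 2 statements merged into one kernel-verified Lean document; each statement's English description precedes it below -/
import Mathlib

section
/- For every integer n ≥ 3, the complete graph K_n satisfies fgndi_Σ(K_n) = 3; that is, K_n admits an NFSD total 3-coloring but no NFSD total 2-coloring. -/
open SimpleGraph Finset

-- The weight of a vertex `x`: its own color, plus the colors of its incident
-- edges, plus the colors of its neighbors.
open scoped Classical in
noncomputable def nfsdWeight {V : Type*} [Fintype V] (G : SimpleGraph V)
    (fV : V → ℕ) (fE : Sym2 V → ℕ) (x : V) : ℕ :=
  fV x + ∑ y ∈ univ.filter (fun y => G.Adj x y), (fE s(x, y) + fV y)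

/-- `fV, fE` is a neighbor full sum distinguishing total `k`-coloring of `G`:
all colors lie in `{1, …, k}` and adjacent vertices get distinct weights. -/
def IsNFSD {V : Type*} [Fintype V] (G : SimpleGraph V) (k : ℕ)
    (fV : V → ℕ) (fE : Sym2 V → ℕ) : Prop :=
  (∀ v, fV v ∈ Finset.Icc 1 k) ∧
  (∀ e ∈ G.edgeSet, fE e ∈ Finset.Icc 1 k) ∧
  (∀ x y, G.Adj x y → nfsdWeight G fV fE x ≠ nfsdWeight G fV fE y)

/-- `G` admits a neighbor full sum distinguishing total `k`-coloring. -/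
def HasNFSD {V : Type*} [Fintype V] (G : SimpleGraph V) (k : ℕ) : Prop :=
  ∃ fV fE, IsNFSD G k fV fE

/-- The neighbor full sum distinguishing total chromatic number `fgndi_Σ(G)`. -/
noncomputable def fgndi {V : Type*} [Fintype V] (G : SimpleGraph V) : ℕ :=
  sInf {k | HasNFSD G k}

lemma nfsdWeight_top {n : ℕ} (fV : Fin n → ℕ) (fE : Sym2 (Fin n) → ℕ) (x : Fin n) :
    nfsdWeight (⊤ : SimpleGraph (Fin n)) fV fE x =
      ∑ y, fV y + ∑ y ∈ univ.erase x, fE s(x, y) := by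
  rw [nfsdWeight, ← add_sum_erase univ fV (mem_univ x), add_assoc,
    add_comm (∑ y ∈ univ.erase x, fV y), ← sum_add_distrib]
  congr 1
  refine sum_congr ?_ fun _ _ => rfl
  ext y
  simp [eq_comm]

lemma HasNFSD.mono {V : Type*} [Fintype V] {G : SimpleGraph V} {k l : ℕ} (hkl : k ≤ l)
    (h : HasNFSD G k) : HasNFSD G l := by
  obtain ⟨fV, fE, hV, hE, hne⟩ := h
  exact ⟨fV, fE, fun v => Icc_subset_Icc_right hkl (hV v),
    fun e he => Icc_subset_Icc_right hkl (hE e he), hne⟩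

/-- The color of an edge whose endpoints sum to `s`, compared with the threshold `2 * m`. -/
def thresholdColor (m s : ℕ) : ℕ :=
  if 2 * m < s then 3 else if s = 2 * m then 2 else 1

lemma sum_range_thresholdColor {m i : ℕ} (hi : i ≤ 2 * m) (N : ℕ) :
    ∑ j ∈ range N, thresholdColor m (i + j) =
      N + (N + i - 2 * m) + (N + i - (2 * m + 1)) := by
  induction N with
  | zero => simp; omega
  | succ N ih =>
    rw [sum_range_succ, ih, thresholdColor]
    split_ifs <;> omega

lemma hasNFSD_top_three {n : ℕ} (hn : 3 ≤ n) : HasNFSD (⊤ : SimpleGraph (Fin n)) 3 := by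
  let fE : Sym2 (Fin n) → ℕ := Sym2.lift
    ⟨fun i j => thresholdColor (n / 2) (i + j), fun i j => by simp only [add_comm]⟩
  have hsum (x : Fin n) : thresholdColor (n / 2) (x + x) + ∑ y ∈ univ.erase x, fE s(x, y) =
      n + (n + x - 2 * (n / 2)) + (n + x - (2 * (n / 2) + 1)) := by
    rw [← sum_range_thresholdColor (by omega : (x : ℕ) ≤ 2 * (n / 2)) n,
      ← Fin.sum_univ_eq_sum_range (fun j => thresholdColor (n / 2) (x + j))]
    exact add_sum_erase univ (fun y => fE s(x, y)) (mem_univ x)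
  refine ⟨fun _ => 1, fE, fun _ => by simp, fun e _ => ?_, fun x y hxy => ?_⟩
  · induction e with
    | h i j =>
      change thresholdColor (n / 2) (i + j) ∈ Icc 1 3
      rw [thresholdColor]
      split_ifs <;> simp
  · rw [nfsdWeight_top, nfsdWeight_top]
    have hx := hsum x
    have hy := hsum y
    have hne : (x : ℕ) ≠ y := fun h => hxy.ne (Fin.ext h)
    intro h
    rw [thresholdColor] at hx hy
    split_ifs at hx hy <;> omega

lemma not_hasNFSD_top_two {n : ℕ} (hn : 3 ≤ n) : ¬ HasNFSD (⊤ : SimpleGraph (Fin n)) 2 := by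
  rintro ⟨fV, fE, -, hE, hne⟩
  have hcol {x y : Fin n} (hy : y ∈ univ.erase x) : 1 ≤ fE s(x, y) ∧ fE s(x, y) ≤ 2 :=
    mem_Icc.mp (hE s(x, y) (by simpa [eq_comm] using hy))
  let W (x : Fin n) : ℕ := ∑ y ∈ univ.erase x, fE s(x, y)
  have hlow (x : Fin n) : ∑ _y ∈ univ.erase x, 1 = n - 1 := by simp
  have hhigh (x : Fin n) : ∑ _y ∈ univ.erase x, 2 = 2 * (n - 1) := by simp [mul_comm]
  have hinj : Function.Injective W := by
    intro x y hxy
    by_contra h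
    exact hne x y h (by rw [nfsdWeight_top, nfsdWeight_top]; exact congrArg _ hxy)
  have himage : univ.image W = Icc (n - 1) (2 * (n - 1)) := by
    apply eq_of_subset_of_card_le
    · intro w hw
      obtain ⟨x, -, rfl⟩ := mem_image.mp hw
      rw [mem_Icc, ← hhigh x, ← hlow x]
      exact ⟨sum_le_sum fun y hy => (hcol hy).1, sum_le_sum fun y hy => (hcol hy).2⟩
    · rw [card_image_of_injective _ hinj, Nat.card_Icc, card_univ, Fintype.card_fin]
      omega
  obtain ⟨x, -, hx⟩ := mem_image.mp
    (himage ▸ mem_Icc.mpr ⟨le_rfl, by omega⟩ : n - 1 ∈ univ.image W)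
  obtain ⟨y, -, hy⟩ := mem_image.mp
    (himage ▸ mem_Icc.mpr ⟨by omega, le_rfl⟩ : 2 * (n - 1) ∈ univ.image W)
  have hxy : x ≠ y := by
    rintro rfl
    omega
  have h1 := (sum_eq_sum_iff_of_le fun z hz => (hcol hz).1).mp ((hlow x).trans hx.symm)
    y (by simpa using hxy.symm)
  have h2 := (sum_eq_sum_iff_of_le fun z hz => (hcol hz).2).mp (hy.trans (hhigh y).symm)
    x (by simpa using hxy)
  rw [Sym2.eq_swap] at h2
  omega

theorem stmt_11 (n : ℕ) (hn : 3 ≤ n) :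
    fgndi (⊤ : SimpleGraph (Fin n)) = 3 ∧
      HasNFSD (⊤ : SimpleGraph (Fin n)) 3 ∧ ¬ HasNFSD (⊤ : SimpleGraph (Fin n)) 2 := by
  refine ⟨?_, hasNFSD_top_three hn, not_hasNFSD_top_two hn⟩
  refine IsLeast.csInf_eq ⟨hasNFSD_top_three hn, fun k hk => ?_⟩
  by_contra h
  exact not_hasNFSD_top_two hn (HasNFSD.mono (by omega) hk)
end

section
/- Let T be a tree (a finite connected acyclic simple graph) with at least three vertices. If T contains two adjacent vertices of equal degree, then fgndi_Σ(T) = 2; that is, T admits an NFSD total 2-coloring but no NFSD total 1-coloring. -/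
open SimpleGraph Finset

namespace SimpleGraph

open scoped Classical in
/-- The walk from `a` to `b` supports an edge labelling over `ZMod 2` whose vertex sums are
the indicator of `a` plus the indicator of `b`. -/
lemma Walk.exists_edge_labelling_zmod_two {V : Type*} [Fintype V] {G : SimpleGraph V} {a b : V}
    (w : G.Walk a b) :
    ∃ h : Sym2 V → ZMod 2, ∀ x, ∑ y ∈ univ.filter (fun y => G.Adj x y), h s(x, y) =
      (if x = a then 1 else 0) + (if x = b then 1 else 0) := by
  induction w with
  | nil => exact ⟨0, fun x => by split_ifs <;> simp; rfl⟩
  | @cons a c b hac w ih =>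
    obtain ⟨h, hh⟩ := ih
    refine ⟨fun e => (if e = s(a, c) then 1 else 0) + h e, fun x => ?_⟩
    rw [sum_add_distrib, hh]
    have hne := hac.ne
    have key : ∑ y ∈ univ.filter (fun y => G.Adj x y),
        (if s(x, y) = s(a, c) then (1 : ZMod 2) else 0) =
        (if x = a then 1 else 0) + (if x = c then 1 else 0) := by
      by_cases hxa : x = a
      · subst hxa
        simp [hne, hac]
      · by_cases hxc : x = c
        · subst hxc
          simp [hxa, hac.symm]
        · simp [hxa, hxc]
    rw [key, add_assoc, ← add_assoc (if x = c then (1 : ZMod 2) else 0), CharTwo.add_self_eq_zero,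
      zero_add]

open scoped Classical in
/-- In a connected graph the vertex sums of an edge labelling over `ZMod 2` can be prescribed
at all vertices but one. -/
lemma Connected.exists_edge_labelling_zmod_two {V : Type*} [Fintype V] {G : SimpleGraph V}
    (hG : G.Connected) (r : V) (p : V → ZMod 2) :
    ∃ h : Sym2 V → ZMod 2, ∀ x, x ≠ r →
      ∑ y ∈ univ.filter (fun y => G.Adj x y), h s(x, y) = p x := by
  choose h hh using fun a => (hG.preconnected a r).some.exists_edge_labelling_zmod_two
  refine ⟨fun e => ∑ a, p a * h a e, fun x hx => ?_⟩
  rw [sum_comm]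
  simp_rw [← mul_sum, hh]
  simp [hx]

/-- In a connected graph with at least three vertices, the neighbor of a leaf has
another neighbor. -/
lemma Connected.exists_adj_ne_of_leaf {V : Type*} [Fintype V] {G : SimpleGraph V}
    (hG : G.Connected) (hcard : 3 ≤ Fintype.card V) {r w : V} (hw : ∀ y, G.Adj r y → y = w) :
    ∃ z, G.Adj w z ∧ z ≠ r := by
  classical
  obtain ⟨z, hz⟩ : ∃ z, z ∉ ({r, w} : Finset V) := by
    by_contra! hall
    have h1 := card_le_card (fun z _ => hall z : (univ : Finset V) ⊆ {r, w})
    have h2 := card_le_two (a := r) (b := w)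
    rw [card_univ] at h1
    lia
  obtain ⟨d, -, hd1, hd2⟩ := (hG.preconnected r z).some.exists_boundary_dart {r, w}
    (by simp) (by simpa using hz)
  simp only [Set.mem_insert_iff, Set.mem_singleton_iff, not_or] at hd1 hd2
  have hd := d.adj
  rcases hd1 with h | h
  · exact absurd (hw _ (h ▸ hd)) hd2.2
  · exact ⟨d.snd, h ▸ hd, hd2.1⟩

end SimpleGraph

lemma not_hasNFSD_zero {V : Type*} [Fintype V] [Nonempty V] (G : SimpleGraph V) :
    ¬ HasNFSD G 0 := by
  rintro ⟨fV, fE, hV, -⟩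
  simpa using hV (Classical.arbitrary V)

lemma not_hasNFSD_one {V : Type*} [Fintype V] (G : SimpleGraph V) [DecidableRel G.Adj]
    {u v : V} (huv : G.Adj u v) (hdeg : G.degree u = G.degree v) : ¬ HasNFSD G 1 := by
  classical
  rintro ⟨fV, fE, hV, hE, hne⟩
  simp only [Icc_self, mem_singleton] at hV hE
  have hweight : ∀ x, nfsdWeight G fV fE x = 1 + G.degree x * 2 := by
    intro x
    rw [nfsdWeight, hV, sum_congr rfl (g := fun _ => 2), sum_const, smul_eq_mul,
      ← card_neighborFinset_eq_degree, neighborFinset_eq_filter]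
    · congr!
    · intro y hy
      rw [hV, hE _ (by simpa using hy)]
  exact hne u v huv (by rw [hweight, hweight, hdeg])

lemma SimpleGraph.IsTree.hasNFSD_two {V : Type*} [Fintype V] {T : SimpleGraph V}
    (htree : T.IsTree) (hcard : 3 ≤ Fintype.card V) : HasNFSD T 2 := by
  classical
  have : Nontrivial V := Fintype.one_lt_card_iff_nontrivial.mp (by lia)
  obtain ⟨r, hr⟩ := htree.exists_vert_degree_one_of_nontrivial
  obtain ⟨w, hrw, hw⟩ := degree_eq_one_iff_existsUnique_adj.mp hr
  obtain ⟨z, hwz, hzr⟩ := htree.connected.exists_adj_ne_of_leaf hcard hw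
  let C := htree.coloringTwo
  let c : V → ZMod 2 := C
  obtain ⟨h, hh⟩ := htree.connected.exists_edge_labelling_zmod_two r c
  let fV : V → ℕ := fun _ => 1
  let fE : Sym2 V → ℕ := fun e => 1 + (h e).val
  have hcast : ∀ x, x ≠ r → (nfsdWeight T fV fE x : ZMod 2) = 1 + c x := by
    intro x hx
    have h2 : ∀ e, (1 + h e + 1 : ZMod 2) = h e := fun e => by
      rw [add_right_comm, CharTwo.add_self_eq_zero, zero_add]
    rw [nfsdWeight, ← hh x hx]
    simp [fV, fE, h2]
  have hlt : nfsdWeight T fV fE r < nfsdWeight T fV fE w := by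
    have hfr : univ.filter (fun y => T.Adj r y) = {w} := by
      ext y
      simpa using ⟨hw y, fun e => e ▸ hrw⟩
    have hsub : ({r, z} : Finset V) ⊆ univ.filter (fun y => T.Adj w y) := by
      simp [insert_subset_iff, hrw.symm, hwz]
    have hle := sum_le_sum_of_subset (f := fun y => fE s(w, y) + fV y) hsub
    rw [sum_pair hzr.symm] at hle
    simp only [nfsdWeight, hfr, sum_singleton, Sym2.eq_swap (a := r) (b := w)]
    simp only [fV] at hle ⊢
    lia
  refine ⟨fV, fE, by simp [fV], fun e _ => ?_, fun x y hxy heq => ?_⟩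
  · have := ZMod.val_lt (h e)
    simp only [fE, mem_Icc]
    lia
  · by_cases hx : x = r
    · subst hx
      obtain rfl := hw y hxy
      exact hlt.ne heq
    by_cases hy : y = r
    · subst hy
      obtain rfl := hw x hxy.symm
      exact hlt.ne' heq
    have := congrArg (Nat.cast : ℕ → ZMod 2) heq
    rw [hcast x hx, hcast y hy] at this
    have hc : c x = c y := add_left_cancel this
    exact C.valid hxy hc

theorem stmt_14 {V : Type*} [Fintype V] (T : SimpleGraph V) [DecidableRel T.Adj]
    (htree : T.IsTree) (hcard : 3 ≤ Fintype.card V)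
    (hdeg : ∃ u v : V, T.Adj u v ∧ T.degree u = T.degree v) :
    fgndi T = 2 ∧ HasNFSD T 2 ∧ ¬ HasNFSD T 1 := by
  obtain ⟨u, v, huv, hd⟩ := hdeg
  have : Nonempty V := ⟨u⟩
  have h2 := htree.hasNFSD_two hcard
  have h1 := not_hasNFSD_one T huv hd
  refine ⟨le_antisymm (Nat.sInf_le h2) (le_csInf ⟨2, h2⟩ fun k hk => ?_), h2, h1⟩
  match k, hk with
  | 0, hk => exact absurd hk (not_hasNFSD_zero T)
  | 1, hk => exact absurd hk h1
  | k + 2, _ => lia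
end
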